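/- arXiv:2201.04861 — 3 statements merged into one kernel-verified Lean document; each statement's English description precedes it below -/
import Mathlib

section
/- Let k be an algebraically closed field of characteristic p > 0, G a finite p-group acting faithfully on a smooth projective curve X over k with quotient Y = X/G, so that k(X)/k(Y) is a Galois extension with group G. If z ∈ k(X) satisfies tr_{k(X)/k(Y)}(z) ≠ 0, then the set {g^*(z) : g ∈ G} is a k(Y)-basis of k(X). -/
open scoped BigOperators

universe u

/-- The function-field / valuation-theoretic data of a `G`-Galois cover `π : X → Y` of smooth
projective curves over a field `k`:  `F = k(Y)` and `K = k(X)` are the function fields,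
`PtX` and `PtY` are the sets of closed points `X(k)` and `Y(k)`, `proj` is `π` on closed
points, `ordX`/`ordY` are the normalized (additive) valuations at the points,
`ram P i` is the `i`-th lower-numbering ramification group `G_{P,i}` at `P`,
`gY` is the genus of `Y` and `B ⊆ Y(k)` is the branch locus of `π`. -/
structure CurveCover (k : Type u) [Field k] (G : Type u) [Group G] [Fintype G] :
    Type (u + 1) where
  /-- the function field `k(Y)` of the base curve -/
  F : Type u
  [fieldF : Field F]
  [algkF : Algebra k F]
  /-- the function field `k(X)` of the covering curve -/
  K : Type u
  [fieldK : Field K]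
  [algkK : Algebra k K]
  [algFK : Algebra F K]
  [towerFK : IsScalarTower k F K]
  /-- `k(X)/k(Y)` is a Galois extension -/
  [galFK : IsGalois F K]
  /-- the Galois group of `k(X)/k(Y)` is identified with `G` -/
  galOfG : G ≃* (K ≃ₐ[F] K)
  /-- the closed points `X(k)` -/
  PtX : Type u
  /-- the closed points `Y(k)` -/
  PtY : Type u
  /-- the covering map `π` on closed points -/
  proj : PtX → PtY
  proj_surjective : Function.Surjective proj
  /-- the normalized valuation `ord_P` on `k(X)` at a point `P ∈ X(k)` -/
  ordX : PtX → K → ℤ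
  /-- the normalized valuation `ord_Q` on `k(Y)` at a point `Q ∈ Y(k)` -/
  ordY : PtY → F → ℤ
  /-- the lower-numbering ramification filtration `G_{P,i}` at `P ∈ X(k)` -/
  ram : PtX → ℕ → Subgroup G
  ram_antitone : ∀ P : PtX, Antitone (ram P)
  ram_eventually_bot : ∀ P : PtX, ∃ N : ℕ, ∀ i : ℕ, N ≤ i → ram P i = ⊥
  /-- the genus of `Y` -/
  gY : ℕ
  /-- the branch locus `B ⊆ Y(k)` of `π` -/
  B : Finset PtY
  mem_B_iff : ∀ P : PtX, proj P ∈ B ↔ ram P 0 ≠ ⊥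

namespace CurveCover

attribute [instance] fieldF algkF fieldK algkK algFK towerFK galFK

variable {k : Type u} [Field k] {G : Type u} [Group G] [Fintype G]

/-- `d'_P = Σ_{i ≥ 1} (#G_{P,i} − 1)`. -/
noncomputable def d' (S : CurveCover k G) (P : S.PtX) : ℕ :=
  ∑ᶠ i : ℕ, if 1 ≤ i then Nat.card (S.ram P i) - 1 else 0

/-- `d''_P = Σ_{i ≥ 2} (#G_{P,i} − 1)`. -/
noncomputable def d'' (S : CurveCover k G) (P : S.PtX) : ℕ :=
  ∑ᶠ i : ℕ, if 2 ≤ i then Nat.card (S.ram P i) - 1 else 0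

/-- Condition (A): every stabilizer (inertia) subgroup `G_P = G_{P,0}` is normal in `G`. -/
def CondA (S : CurveCover k G) : Prop := ∀ P : S.PtX, (S.ram P 0).Normal

/-- `z ∈ k(X)` is a *magical element*: `ord_P(z) ≥ −d'_P` for every `P ∈ X(k)` and
`tr_{k(X)/k(Y)}(z) ≠ 0`. -/
def IsMagical (S : CurveCover k G) (z : S.K) : Prop :=
  (∀ P : S.PtX, -(S.d' P : ℤ) ≤ S.ordX P z) ∧ Algebra.trace S.F S.K z ≠ 0

/-- Condition (B): there exists a magical element. -/
def CondB (S : CurveCover k G) : Prop := ∃ z : S.K, S.IsMagical z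

end CurveCover

theorem exists_const_of_pgroup {p : ℕ} [Fact p.Prime] {G : Type*} [Group G] [Fintype G]
    (hG : IsPGroup p G) {F : Type*} [Field F] [CharP F p]
    (W : AddSubgroup (G → F)) (hW : ∀ (h : G) (c : G → F), c ∈ W → (fun g => c (h⁻¹ * g)) ∈ W)
    (c : G → F) (hc : c ∈ W) (hc0 : c ≠ 0) :
    ∃ a : F, a ≠ 0 ∧ (fun _ => a) ∈ W := by
  classical
  letI : Algebra (ZMod p) F := ZMod.algebra F p
  let t : G → (G → F) →ₗ[ZMod p] (G → F) := fun h => LinearMap.funLeft (ZMod p) F (fun g => h⁻¹ * g)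
  have ht : ∀ h d g, t h d g = d (h⁻¹ * g) := fun h d g => rfl
  have t1 : ∀ d, t 1 d = d := fun d => by ext g; simp [ht]
  have tm : ∀ h h' d, t (h * h') d = t h (t h' d) := fun h h' d => by
    ext g; simp [ht, mul_assoc]
  let A : Submodule (ZMod p) (G → F) := Submodule.span (ZMod p) (Set.range fun h => t h c)
  have hA : ∀ h d, d ∈ A → t h d ∈ A := by
    intro h d hd
    have : A ≤ A.comap (t h) := by
      refine Submodule.span_le.2 ?_
      rintro _ ⟨h', rfl⟩
      change t h (t h' c) ∈ A
      rw [← tm]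
      exact Submodule.subset_span ⟨h * h', rfl⟩
    exact this hd
  have hAW : ∀ d ∈ A, d ∈ W := by
    have : A ≤ AddSubgroup.toZModSubmodule p W := by
      refine Submodule.span_le.2 ?_
      rintro _ ⟨h', rfl⟩
      exact hW h' c hc
    exact fun d hd => this hd
  have hcA : c ∈ A := Submodule.subset_span ⟨1, t1 c⟩
  have : Module.Finite (ZMod p) A :=
    Module.Finite.span_of_finite (ZMod p) (Set.finite_range _)
  have : Finite A := Module.finite_of_finite (ZMod p)
  letI : MulAction G A :=
    { smul := fun h d => ⟨t h d.1, hA h d.1 d.2⟩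
      one_smul := fun d => Subtype.ext (t1 d.1)
      mul_smul := fun h h' d => Subtype.ext (tm h h' d.1) }
  have hsm : ∀ (h : G) (d : A), (h • d).1 = t h d.1 := fun _ _ => rfl
  have hdvd : p ∣ Nat.card A := by
    have : addOrderOf (⟨c, hcA⟩ : A) = p := by
      refine addOrderOf_eq_prime ?_ ?_
      · rw [← Nat.cast_smul_eq_nsmul (ZMod p)]; simp
      · intro h; exact hc0 (congrArg Subtype.val h)
    exact this.symm.dvd.trans (addOrderOf_dvd_natCard _)
  have h0 : (0 : A) ∈ MulAction.fixedPoints G A := fun h => Subtype.ext (by rw [hsm]; simp)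
  obtain ⟨d, hd, hd0⟩ := hG.exists_fixed_point_of_prime_dvd_card_of_fixed_point A hdvd h0
  have hconst : ∀ g, d.1 g = d.1 1 := fun g => by
    have := congrFun (congrArg Subtype.val (hd g)) g
    rw [hsm, ht] at this
    simpa using this.symm
  refine ⟨d.1 1, fun h => hd0 (Subtype.ext ?_), ?_⟩
  · ext g; rw [hconst, h]; rfl
  · have := hAW d.1 d.2
    rwa [show d.1 = fun _ => d.1 1 from funext hconst] at this

/-- **Normal basis from a nonzero trace element.**
Let `k` be an algebraically closed field of characteristic `p > 0` and let the finite
`p`-group `G` act faithfully on a smooth projective curve `X` over `k`, with quotient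
`Y = X/G`, so that `k(X)/k(Y)` is Galois with group `G`.  If `z ∈ k(X)` has
`tr_{k(X)/k(Y)}(z) ≠ 0`, then `{g^*(z) : g ∈ G}` is a `k(Y)`-basis of `k(X)`. -/
theorem magical_element_is_normal_basis
    (p : ℕ) [Fact p.Prime] (k : Type u) [Field k] [IsAlgClosed k] [CharP k p]
    (G : Type u) [Group G] [Fintype G] (hG : IsPGroup p G)
    (S : CurveCover k G) (z : S.K)
    (hz : Algebra.trace S.F S.K z ≠ 0) :
    LinearIndependent S.F (fun g : G => S.galOfG g z) ∧
      Submodule.span S.F (Set.range fun g : G => S.galOfG g z) = ⊤ := by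
  classical
  have : CharP S.F p := charP_of_injective_algebraMap (algebraMap k S.F).injective p
  have : Finite (S.K ≃ₐ[S.F] S.K) := Finite.of_equiv G S.galOfG.toEquiv
  have : FiniteDimensional S.F S.K := IsGalois.finiteDimensional_of_finite S.F S.K
  have htr : algebraMap S.F S.K (Algebra.trace S.F S.K z) = ∑ g : G, S.galOfG g z := by
    rw [trace_eq_sum_automorphisms]
    exact (Fintype.sum_equiv S.galOfG.toEquiv _ _ fun _ => rfl).symm
  have hli : LinearIndependent S.F (fun g : G => S.galOfG g z) := by
    rw [Fintype.linearIndependent_iff]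
    by_contra! hcon
    obtain ⟨c, hc, i, hi⟩ := hcon
    let L : (G → S.F) →ₗ[S.F] S.K := Fintype.linearCombination S.F (fun g : G => S.galOfG g z)
    have hL : ∀ d, L d = ∑ g, d g • S.galOfG g z := fun d => rfl
    obtain ⟨a, ha, haW⟩ := exists_const_of_pgroup hG (LinearMap.ker L).toAddSubgroup
      (by
        intro h d hd
        replace hd : L d = 0 := hd
        change L _ = 0
        have : L (fun g => d (h⁻¹ * g)) = S.galOfG h (L d) := by
          rw [hL, hL, map_sum]
          refine (Fintype.sum_equiv (Equiv.mulLeft h) _ _ fun g => ?_).symm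
          simp
        rw [this, hd, map_zero])
      c hc (fun h => hi (by rw [h]; rfl))
    replace haW : L (fun _ => a) = 0 := haW
    rw [hL, ← Finset.smul_sum, ← htr, smul_eq_zero] at haW
    rcases haW with h | h
    · exact ha h
    · exact hz ((map_eq_zero _).1 h)
  refine ⟨hli, hli.span_eq_top_of_card_eq_finrank' ?_⟩
  rw [← IsGalois.card_aut_eq_finrank S.F S.K, ← Nat.card_eq_fintype_card]
  exact Nat.card_congr S.galOfG.toEquiv
end

section
/- Group Determinant Formula: let p be a prime and G a finite p-group. In the polynomial ring F_p[x_g : g ∈ G], the determinant of the #G × #G matrix [x_{gh}]_{g,h ∈ G} (rows and columns indexed by G, with (g,h)-entry x_{g·h}) equals ε·(Σ_{g∈G} x_g)^{#G}, where ε ∈ {1, −1} is the sign of the permutation h ↦ h^{−1} of G. -/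
open scoped BigOperators

universe u

/-- A nonzero finite `p`-group of functions stable under right translation contains a nonzero
constant function. -/
lemma exists_const_ne_zero (p : ℕ) [Fact p.Prime] {G : Type*} [Group G] [Fintype G]
    (hG : IsPGroup p G) {K : Type*} [Field K] [Algebra (ZMod p) K]
    (W : Submodule (ZMod p) (G → K)) [Finite W] [Nontrivial W]
    (hW : ∀ w ∈ W, ∀ k : G, (fun h => w (h * k)) ∈ W) :
    ∃ c : K, c ≠ 0 ∧ (fun _ => c) ∈ W := by
  letI : MulAction G W :=
    { smul := fun k w => ⟨fun h => w.1 (h * k), hW w.1 w.2 k⟩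
      one_smul := fun w => Subtype.ext (funext fun h => congrArg w.1 (mul_one h))
      mul_smul := fun k l w => Subtype.ext (funext fun h =>
        congrArg w.1 (mul_assoc h k l).symm) }
  have hcard : p ∣ Nat.card W := by
    rw [Module.natCard_eq_pow_finrank (K := ZMod p), Nat.card_zmod]
    exact dvd_pow_self p (Module.finrank_pos).ne'
  have h0 : (0 : W) ∈ MulAction.fixedPoints G W := fun k => Subtype.ext rfl
  obtain ⟨b, hb, hne⟩ :=
    hG.exists_fixed_point_of_prime_dvd_card_of_fixed_point W hcard h0
  have hconst : ∀ k, b.1 k = b.1 1 := fun k => by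
    have h := congrFun (congrArg Subtype.val (hb k)) 1
    have h2 : b.1 (1 * k) = b.1 1 := h
    rwa [one_mul] at h2
  have hb' : b.1 = fun _ => b.1 1 := funext hconst
  refine ⟨b.1 1, fun h => hne ?_, hb' ▸ b.2⟩
  apply Subtype.ext
  rw [hb', h]
  rfl

lemma eigen_eq_sum (p : ℕ) [Fact p.Prime] {G : Type*} [Group G] [Fintype G]
    (hG : IsPGroup p G) {K : Type*} [Field K] [Algebra (ZMod p) K]
    (f : G → K) (c : K) (v : G → K) (hv : v ≠ 0)
    (h : ∀ g, ∑ x, f (g * x⁻¹) * v x = c * v g) : c = ∑ g, f g := by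
  classical
  let T : (G → ZMod p) →ₗ[ZMod p] (G → K) :=
    ∑ g : G, (LinearMap.proj g).smulRight (fun x => v (x * g))
  have hT : ∀ a x, T a x = ∑ g, a g • v (x * g) := fun a x => by
    simp [T, Finset.sum_apply]
  let W := LinearMap.range T
  have hvW : v ∈ W := ⟨Pi.single 1 1, by
    ext x
    rw [hT, Finset.sum_eq_single 1] <;> simp +contextual [Pi.single_apply]⟩
  haveI : Finite W := Finite.of_surjective T.rangeRestrict T.surjective_rangeRestrict
  haveI : Nontrivial W := ⟨⟨⟨v, hvW⟩, 0, fun h => hv (congrArg Subtype.val h)⟩⟩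
  have hW : ∀ w ∈ W, ∀ k : G, (fun h => w (h * k)) ∈ W := by
    rintro _ ⟨a, rfl⟩ k
    refine ⟨fun g => a (k⁻¹ * g), ?_⟩
    ext x
    rw [hT, hT]
    rw [← Equiv.sum_comp (Equiv.mulLeft k)]
    simp [mul_assoc]
  obtain ⟨d, hd, a, ha⟩ := exists_const_ne_zero p hG W hW
  have hE : ∑ x, f (1 * x⁻¹) * T a x = c * T a 1 := by
    simp only [hT, Finset.mul_sum]
    rw [Finset.sum_comm]
    refine Finset.sum_congr rfl fun k _ => ?_
    simp only [mul_smul_comm, ← Finset.smul_sum]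
    congr 1
    rw [one_mul, ← h k, ← Equiv.sum_comp (Equiv.mulRight k) fun x => f (k * x⁻¹) * v x]
    simp
  rw [ha] at hE
  simp only [one_mul, ← Finset.sum_mul] at hE
  rw [← mul_right_cancel₀ hd hE]
  exact Equiv.sum_comp (Equiv.inv G) f

lemma det_conv (p : ℕ) [Fact p.Prime] {G : Type*} [Group G] [Fintype G] [DecidableEq G]
    (hG : IsPGroup p G) {K : Type*} [Field K] [IsAlgClosed K] [Algebra (ZMod p) K]
    (f : G → K) :
    (Matrix.of fun g h : G => f (g * h⁻¹)).det = (∑ g, f g) ^ Fintype.card G := by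
  set A : Matrix G G K := Matrix.of fun g h : G => f (g * h⁻¹) with hA
  rw [Matrix.det_eq_prod_roots_charpoly]
  have hall : ∀ c ∈ A.charpoly.roots, c = ∑ g, f g := by
    intro c hc
    have hr := Polynomial.isRoot_of_mem_roots hc
    rw [Polynomial.IsRoot, Matrix.eval_charpoly] at hr
    obtain ⟨v, hv, hv2⟩ := Matrix.exists_mulVec_eq_zero_iff.mpr hr
    refine eigen_eq_sum p hG f c v hv fun g => ?_
    have := congrFun hv2 g
    rw [Matrix.sub_mulVec] at this
    simp [Matrix.mulVec, dotProduct, Matrix.scalar_apply, Matrix.diagonal_apply, hA] at this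
    exact (sub_eq_zero.mp this).symm
  rw [Multiset.eq_replicate_of_mem hall, Multiset.prod_replicate]
  congr 1
  rw [← (IsAlgClosed.splits A.charpoly).natDegree_eq_card_roots,
    Matrix.charpoly_natDegree_eq_dim]

/-- **Group Determinant Formula.**  Let `p` be a prime and `G` a finite `p`-group.  In the
polynomial ring `F_p[x_g : g ∈ G]`, the determinant of the `#G × #G` matrix
`[x_{gh}]_{g,h ∈ G}` equals `ε · (Σ_{g ∈ G} x_g)^{#G}`, where `ε ∈ {1, −1}` is the sign of
the permutation `h ↦ h⁻¹` of `G`. -/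
theorem group_determinant_formula
    (p : ℕ) [Fact p.Prime] (G : Type u) [Group G] [Fintype G] [DecidableEq G]
    (hG : IsPGroup p G) :
    (Matrix.of fun g h : G => (MvPolynomial.X (g * h) : MvPolynomial G (ZMod p))).det =
      ((Equiv.Perm.sign (Equiv.inv G) : ℤ) : MvPolynomial G (ZMod p)) *
        (∑ g : G, MvPolynomial.X g) ^ Fintype.card G := by
  let R := MvPolynomial G (ZMod p)
  let K := AlgebraicClosure (FractionRing R)
  let φ : R →+* K := (algebraMap (FractionRing R) K).comp (algebraMap R (FractionRing R))
  have hφ : Function.Injective φ :=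
    (algebraMap (FractionRing R) K).injective.comp (IsFractionRing.injective R (FractionRing R))
  letI : Algebra (ZMod p) K := (φ.comp (algebraMap (ZMod p) R)).toAlgebra
  have key : (Matrix.of fun g h : G => (MvPolynomial.X (g * h⁻¹) : R)).det =
      (∑ g : G, MvPolynomial.X g) ^ Fintype.card G := by
    apply hφ
    rw [RingHom.map_det, map_pow, map_sum]
    exact det_conv p hG fun g => φ (MvPolynomial.X g)
  rw [← key, ← Matrix.det_permute']
  congr 1
  ext1 g h
  simp
end

section
/- In an abelian category, consider a commutative diagram with rows A ↪ B ↠ C and A' ↪ B' ↠ C' (A → B, A' → B' monomorphisms; B → C, B' → C' epimorphisms) and vertical monomorphisms A → A', B → B', C → C'. Assume: (i) the map B → B' induces an isomorphism coker(A → B) ≅ coker(A' → B'); (ii) the composites A → C and A' → C' are epimorphisms; (iii) the outer rectangle (with corners A, C, A', C') is cartesian. Then the right square (with corners B, C, B', C') is cartesian. -/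
open CategoryTheory CategoryTheory.Limits

universe v u

/-- **A cartesian-square lemma in an abelian category.**
Consider a commutative diagram

```
A ↪  B ↠ C
↓    ↓    ↓
A' ↪ B' ↠ C'
```

with rows `A ↪ B ↠ C` and `A' ↪ B' ↠ C'` (the first map of each row a monomorphism, the
second an epimorphism) and monomorphic vertical maps.  Assume that
(i) `B ⟶ B'` induces an isomorphism `coker(A ⟶ B) ≅ coker(A' ⟶ B')`,
(ii) the composites `A ⟶ C` and `A' ⟶ C'` are epimorphisms, and
(iii) the outer rectangle (with corners `A, C, A', C'`) is cartesian.
Then the right-hand square (with corners `B, C, B', C'`) is cartesian. -/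
theorem right_square_cartesian_of_outer_cartesian
    {𝒜 : Type u} [Category.{v} 𝒜] [Abelian 𝒜]
    {A B C A' B' C' : 𝒜}
    (f : A ⟶ B) (g : B ⟶ C) (f' : A' ⟶ B') (g' : B' ⟶ C')
    (a : A ⟶ A') (b : B ⟶ B') (c : C ⟶ C')
    [Mono f] [Mono f'] [Epi g] [Epi g'] [Mono a] [Mono b] [Mono c]
    (w₁ : f ≫ b = a ≫ f') (w₂ : g ≫ c = b ≫ g')
    (hcoker : IsIso (Limits.cokernel.map f f' a b w₁))
    (hAC : Epi (f ≫ g)) (hAC' : Epi (f' ≫ g'))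
    (houter : IsPullback (f ≫ g) a c (f' ≫ g')) :
    IsPullback g b c g' := by
  have hl : Epi (pullback.lift g b w₂) := by
    rw [epi_iff_surjective_up_to_refinements]
    intro W p
    have hepi : Epi (cokernel.π f ≫ cokernel.map f f' a b w₁) := inferInstance
    obtain ⟨W', e, he, y, hy⟩ := surjective_up_to_refinements_of_epi
      (cokernel.π f ≫ cokernel.map f f' a b w₁) (p ≫ pullback.snd c g' ≫ cokernel.π f')
    have h0 : (e ≫ p ≫ pullback.snd c g' - y ≫ b) ≫ cokernel.π f' = 0 := by
      simp only [cokernel.π_desc, cokernel.map] at hy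
      simp only [Preadditive.sub_comp, Category.assoc, hy, sub_self]
    obtain ⟨t, ht⟩ : ∃ t : W' ⟶ A', t ≫ f' = e ≫ p ≫ pullback.snd c g' - y ≫ b :=
      ⟨(ShortComplex.exact_cokernel f').lift _ h0, (ShortComplex.exact_cokernel f').lift_f _ h0⟩
    have hc : (e ≫ p ≫ pullback.fst c g' - y ≫ g) ≫ c = t ≫ f' ≫ g' := by
      rw [← Category.assoc t, ht]
      simp only [Preadditive.sub_comp, Category.assoc, w₂, pullback.condition]
    have hb : e ≫ p ≫ pullback.snd c g' = (y + houter.lift _ _ hc ≫ f) ≫ b := by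
      rw [Preadditive.add_comp, Category.assoc, w₁, houter.lift_snd_assoc, ht]
      abel
    refine ⟨W', e, he, y + houter.lift _ _ hc ≫ f, ?_⟩
    apply pullback.hom_ext
    · rw [Category.assoc, Category.assoc, pullback.lift_fst, Preadditive.add_comp,
        Category.assoc, houter.lift_fst]
      abel
    · rw [Category.assoc, Category.assoc, pullback.lift_snd, hb]
  have hm : Mono (pullback.lift g b w₂) :=
    mono_of_mono_fac (pullback.lift_snd g b w₂)
  have : IsIso (pullback.lift g b w₂) := isIso_of_mono_of_epi _
  exact IsPullback.of_iso_pullback ⟨w₂⟩ (asIso (pullback.lift g b w₂))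
    (pullback.lift_fst _ _ _) (pullback.lift_snd _ _ _)
end
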